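/- arXiv:math/0211095 — 4 statements merged into one kernel-verified Lean document; each statement's English description precedes it below -/
import Mathlib

section
/- Let k be a field, A a commutative k-algebra, Ξ : A → A a k-linear map, and Ψ the associated invariant of rooted trees. Then Ψ distinguishes rooted trees (i.e. Ψ : RootedTree → A is injective) if and only if Ψ is finer than α, that is, for all rooted trees T₁, T₂, α(T₁) ≠ α(T₂) implies Ψ(T₁) ≠ Ψ(T₂). -/
namespace ZhaoForest

inductive PreTree : Type
  | node : List PreTree → PreTree

namespace PreTree

def children : PreTree → List PreTree
  | node l => l

inductive Equiv : PreTree → PreTree → Prop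
  | refl (t) : Equiv t t
  | symm {a b} : Equiv a b → Equiv b a
  | trans {a b c} : Equiv a b → Equiv b c → Equiv a c
  | perm {l l'} : l.Perm l' → Equiv (node l) (node l')
  | congr {a b} (l₁ l₂ : List PreTree) : Equiv a b →
      Equiv (node (l₁ ++ a :: l₂)) (node (l₁ ++ b :: l₂))

instance setoid : Setoid PreTree := ⟨Equiv, ⟨Equiv.refl, Equiv.symm, Equiv.trans⟩⟩

/-- number of vertices -/
def size : PreTree → ℕ
  | node l => 1 + (l.attach.map fun x => size x.1).sum
decreasing_by
  have h := List.sizeOf_lt_of_mem x.2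
  simp only [PreTree.node.sizeOf_spec]
  omega

end PreTree

/-- Isomorphism classes of rooted trees. -/
def RootedTree := Quotient PreTree.setoid

namespace RootedTree

/-- vertex count -/
noncomputable def v (T : RootedTree) : ℕ := T.out.size

/-- `B₊`: join the members of a forest to a new root. -/
noncomputable def node (m : Multiset RootedTree) : RootedTree :=
  ⟦PreTree.node ((m.map Quotient.out).toList)⟧

end RootedTree

open Classical in
/-- symmetry factor `α` on representatives -/
noncomputable def PreTree.alphaAux : PreTree → ℕ
  | .node l =>
    let m : Multiset RootedTree :=
      Multiset.ofList (α := RootedTree) (l.map fun t => (⟦t⟧ : RootedTree))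
    (∏ U ∈ m.toFinset, (m.count U).factorial) *
    (l.attach.map fun x => PreTree.alphaAux x.1).prod
decreasing_by
  have h := List.sizeOf_lt_of_mem x.2
  simp only [PreTree.node.sizeOf_spec]
  omega

/-- The order of the automorphism group of a rooted tree. -/
noncomputable def RootedTree.alpha (T : RootedTree) : ℕ := PreTree.alphaAux T.out

section Psi

variable {k A : Type} [Field k] [CommRing A] [Algebra k A]

/-- the invariant `Ψ` on representatives -/
noncomputable def PreTree.psiAux (Ξ : A →ₗ[k] A) : PreTree → A
  | .node l => Ξ (l.attach.map fun x => PreTree.psiAux Ξ x.1).prod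
decreasing_by
  have h := List.sizeOf_lt_of_mem x.2
  simp only [PreTree.node.sizeOf_spec]
  omega

/-- The invariant `Ψ` of rooted trees associated to `Ξ`. -/
noncomputable def RootedTree.psi (Ξ : A →ₗ[k] A) (T : RootedTree) : A :=
  PreTree.psiAux Ξ T.out

/-- The invariant `Ψ` of rooted forests. -/
noncomputable def psiForest (Ξ : A →ₗ[k] A) (F : Multiset RootedTree) : A :=
  (F.map (RootedTree.psi Ξ)).prod

end Psi

/-- The isomorphism class of a representative. -/
def RootedTree.mk (t : PreTree) : RootedTree := ⟦t⟧

theorem RootedTree.mk_out (T : RootedTree) : mk T.out = T := Quotient.out_eq T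

open Classical in
/-- The product of the factorials of the multiplicities of a forest. -/
noncomputable def multFactorial (m : Multiset RootedTree) : ℕ :=
  ∏ U ∈ m.toFinset, (m.count U).factorial

theorem multFactorial_pos (m : Multiset RootedTree) : 0 < multFactorial m :=
  Finset.prod_pos fun _ _ => Nat.factorial_pos _

theorem multFactorial_pair_self (T : RootedTree) :
    multFactorial (Multiset.ofList [T, T]) = 2 := by
  classical
  have h : (Multiset.ofList [T, T]).toFinset = {T} := by ext; simp
  have hc : (Multiset.ofList [T, T]).count T = 2 := by simp
  unfold multFactorial
  convert Finset.prod_singleton (fun U => ((Multiset.ofList [T, T]).count U).factorial) T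
  rw [hc]
  rfl

theorem multFactorial_of_nodup {m : Multiset RootedTree} (h : m.Nodup) :
    multFactorial m = 1 := by
  classical
  exact Finset.prod_eq_one fun U _ =>
    Nat.factorial_eq_one.mpr (Multiset.nodup_iff_count_le_one.mp h U)

namespace PreTree

theorem alphaAux_node (l : List PreTree) :
    alphaAux (node l) =
      multFactorial (Multiset.ofList (l.map RootedTree.mk)) * (l.map alphaAux).prod := by
  rw [alphaAux]
  simp only [List.map_subtype, List.unattach_attach]
  rfl

theorem alphaAux_pos : ∀ t : PreTree, 0 < alphaAux t
  | node l => by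
    rw [alphaAux_node]
    refine Nat.mul_pos (multFactorial_pos _) ?_
    refine List.prod_pos fun x hx => ?_
    obtain ⟨t, ht, rfl⟩ := List.mem_map.mp hx
    exact alphaAux_pos t
decreasing_by
  have h := List.sizeOf_lt_of_mem ht
  simp only [PreTree.node.sizeOf_spec]
  omega

theorem Equiv.alphaAux_eq {a b : PreTree} (h : Equiv a b) : alphaAux a = alphaAux b := by
  induction h with
  | refl => rfl
  | symm _ ih => exact ih.symm
  | trans _ _ ih₁ ih₂ => exact ih₁.trans ih₂
  | perm h =>
    rw [alphaAux_node, alphaAux_node, Multiset.coe_eq_coe.mpr (h.map _), (h.map _).prod_eq]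
  | @congr a b l₁ l₂ h ih =>
    have hq : RootedTree.mk a = RootedTree.mk b := Quotient.sound h
    simp only [alphaAux_node, List.map_append, List.map_cons, hq, ih]

theorem psiAux_node {k A : Type} [Field k] [CommRing A] [Algebra k A] (Ξ : A →ₗ[k] A)
    (l : List PreTree) : psiAux Ξ (node l) = Ξ (l.map (psiAux Ξ)).prod := by
  rw [psiAux]
  simp only [List.map_subtype, List.unattach_attach]

theorem Equiv.psiAux_eq {k A : Type} [Field k] [CommRing A] [Algebra k A] (Ξ : A →ₗ[k] A)
    {a b : PreTree} (h : Equiv a b) : psiAux Ξ a = psiAux Ξ b := by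
  induction h with
  | refl => rfl
  | symm _ ih => exact ih.symm
  | trans _ _ ih₁ ih₂ => exact ih₁.trans ih₂
  | perm h => rw [psiAux_node, psiAux_node, (h.map _).prod_eq]
  | congr l₁ l₂ _ ih => simp only [psiAux_node, List.map_append, List.map_cons, ih]

end PreTree

namespace RootedTree

theorem alpha_mk (t : PreTree) : alpha (mk t) = t.alphaAux :=
  PreTree.Equiv.alphaAux_eq (Quotient.mk_out t)

theorem alpha_pos (T : RootedTree) : 0 < T.alpha :=
  PreTree.alphaAux_pos _

theorem psi_mk {k A : Type} [Field k] [CommRing A] [Algebra k A] (Ξ : A →ₗ[k] A)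
    (t : PreTree) : psi Ξ (mk t) = t.psiAux Ξ :=
  PreTree.Equiv.psiAux_eq Ξ (Quotient.mk_out t)

/-- The tree whose root has exactly the two branches `T₁` and `T₂`. -/
noncomputable def pair (T₁ T₂ : RootedTree) : RootedTree :=
  mk (PreTree.node [T₁.out, T₂.out])

theorem alpha_pair (T₁ T₂ : RootedTree) :
    (pair T₁ T₂).alpha = multFactorial (Multiset.ofList [T₁, T₂]) * (T₁.alpha * T₂.alpha) := by
  rw [pair, alpha_mk, PreTree.alphaAux_node]
  simp only [List.map_cons, List.map_nil, List.prod_cons, List.prod_nil, mk_out, mul_one]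
  rfl

theorem psi_pair {k A : Type} [Field k] [CommRing A] [Algebra k A] (Ξ : A →ₗ[k] A)
    (T₁ T₂ : RootedTree) : psi Ξ (pair T₁ T₂) = Ξ (psi Ξ T₁ * psi Ξ T₂) := by
  rw [pair, psi_mk, PreTree.psiAux_node]
  simp [psi]

end RootedTree

/-- `Ψ` distinguishes rooted trees iff it is finer than `α`. -/
theorem psi_injective_iff_finer_than_alpha (k A : Type) [Field k] [CommRing A]
    [Algebra k A] (Ξ : A →ₗ[k] A) :
    Function.Injective (RootedTree.psi Ξ) ↔
      ∀ T₁ T₂ : RootedTree, T₁.alpha ≠ T₂.alpha →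
        RootedTree.psi Ξ T₁ ≠ RootedTree.psi Ξ T₂ := by
  refine ⟨fun hinj T₁ T₂ hα hΨ => hα (congrArg _ (hinj hΨ)), fun hfine T₁ T₂ hΨ => ?_⟩
  have hα {S₁ S₂ : RootedTree} (h : RootedTree.psi Ξ S₁ = RootedTree.psi Ξ S₂) :
      S₁.alpha = S₂.alpha := by
    by_contra hne
    exact hfine S₁ S₂ hne h
  by_contra hne
  have hpair : (RootedTree.pair T₁ T₁).alpha = (RootedTree.pair T₁ T₂).alpha :=
    hα (by rw [RootedTree.psi_pair, RootedTree.psi_pair, hΨ])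
  rw [RootedTree.alpha_pair, RootedTree.alpha_pair, multFactorial_pair_self,
    multFactorial_of_nodup (by simp [hne]), ← hα hΨ] at hpair
  have hpos := Nat.mul_pos T₁.alpha_pos T₁.alpha_pos
  omega

end ZhaoForest
end

section
/- Let k be a field, A a commutative k-algebra, Ξ : A → A a k-linear map, and Ψ the associated invariant of rooted trees and forests. Then Ψ distinguishes rooted forests if and only if it distinguishes rooted trees; that is, the map F ↦ Ψ(F) = ∏_{T ∈ F} Ψ(T) on multisets of rooted trees is injective if and only if Ψ : RootedTree → A is injective. -/
namespace ZhaoForest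

namespace PreTree

/-- The isomorphism class of a tree. -/
def isoClass (t : PreTree) : RootedTree := Quotient.mk setoid t

/-- The multiset of isomorphism classes of the branches at the root. -/
def branches (t : PreTree) : Multiset RootedTree :=
  (t.children.map isoClass : List RootedTree)

theorem Equiv.isoClass_eq {a b : PreTree} (h : Equiv a b) : a.isoClass = b.isoClass :=
  Quotient.sound h

theorem Equiv.branches_eq {a b : PreTree} (h : Equiv a b) : a.branches = b.branches := by
  induction h with
  | refl => rfl
  | symm _ ih => exact ih.symm
  | trans _ _ ih₁ ih₂ => exact ih₁.trans ih₂
  | perm h => exact Multiset.coe_eq_coe.2 (h.map _)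
  | congr l₁ l₂ h _ =>
    simp only [branches, children, List.map_append, List.map_cons, h.isoClass_eq]

end PreTree

namespace RootedTree

/-- A chosen representative of an isomorphism class. -/
noncomputable def rep (T : RootedTree) : PreTree := Quotient.out T

theorem isoClass_rep (T : RootedTree) : T.rep.isoClass = T := Quotient.out_eq T

theorem rep_node_equiv (F : Multiset RootedTree) :
    PreTree.Equiv (node F).rep (PreTree.node (F.map rep).toList) :=
  Quotient.mk_out (PreTree.node (F.map rep).toList)

theorem node_injective : Function.Injective node := by
  have branches_node (m : Multiset RootedTree) :
      (PreTree.node (m.map rep).toList).branches = m := by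
    simp only [PreTree.branches, PreTree.children]
    rw [← Multiset.map_coe, Multiset.coe_toList, Multiset.map_map]
    simp [isoClass_rep]
  intro F G h
  rw [← branches_node F, ← branches_node G]
  exact (Quotient.exact h : PreTree.Equiv _ _).branches_eq

theorem psi_node {k A : Type} [Field k] [CommRing A] [Algebra k A] (Ξ : A →ₗ[k] A)
    (F : Multiset RootedTree) : psi Ξ (node F) = Ξ (psiForest Ξ F) := by
  change PreTree.psiAux Ξ (node F).rep = _
  rw [(rep_node_equiv F).psiAux_eq, PreTree.psiAux_node, ← Multiset.prod_coe, ← Multiset.map_coe,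
    Multiset.coe_toList, Multiset.map_map]
  rfl

end RootedTree

/-- `Ψ` distinguishes rooted forests iff it distinguishes rooted trees. -/
theorem psiForest_injective_iff_psi_injective (k A : Type) [Field k] [CommRing A]
    [Algebra k A] (Ξ : A →ₗ[k] A) :
    Function.Injective (psiForest Ξ) ↔ Function.Injective (RootedTree.psi Ξ) := by
  constructor
  · intro h T U hTU
    exact Multiset.singleton_inj.1 (h (by simpa [psiForest] using hTU))
  · intro h F G hFG
    exact RootedTree.node_injective
      (h (by rw [RootedTree.psi_node, RootedTree.psi_node, hFG]))

end ZhaoForest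
end

section
/- For every multiset s of rooted trees and every integer n ≥ 0, the number of strict order preserving maps from B₊(s) to [n+1] minus the number of strict order preserving maps from B₊(s) to [n] equals the product over T ∈ s of the number of strict order preserving maps from T to [n]; in symbols, Ω̄(B₊(s))(n+1) − Ω̄(B₊(s))(n) = ∏_{T ∈ s} Ω̄(T)(n). -/
namespace ZhaoForest

namespace PreTree

/-- `t.IsVertex p` : the list of child indices `p` addresses a vertex of `t`.
(`[]` addresses the root.) -/
def IsVertex (t : PreTree) : List ℕ → Prop
  | [] => True
  | i :: p => ∃ h : i < t.children.length, (t.children.get ⟨i, h⟩).IsVertex p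

end PreTree

/-- The set of vertices of a rooted tree, partially ordered by
`p ≤ q ↔ p` is a prefix of `q` (so the root `[]` is the minimum). -/
def Vert (t : PreTree) : Type := {p : List ℕ // t.IsVertex p}

/-- The number of strict order preserving maps from (the poset of vertices of) `t`
to `[n] = {1, …, n}`. -/
noncomputable def PreTree.sCount (t : PreTree) (n : ℕ) : ℕ :=
  Nat.card {σ : Vert t → Fin n // ∀ p q : Vert t, p.1 <+: q.1 → p.1 ≠ q.1 → σ p < σ q}

/-- The number of order preserving maps from (the poset of vertices of) `t`
to `[n] = {1, …, n}`. -/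
noncomputable def PreTree.wCount (t : PreTree) (n : ℕ) : ℕ :=
  Nat.card {σ : Vert t → Fin n // ∀ p q : Vert t, p.1 <+: q.1 → p.1 ≠ q.1 → σ p ≤ σ q}

/-- `Ω̄(T)(n)`: the number of strict order preserving maps `T → [n]`. -/
noncomputable def RootedTree.sCount (T : RootedTree) (n : ℕ) : ℕ := T.out.sCount n

/-- `Ω(T)(n)`: the number of order preserving maps `T → [n]`. -/
noncomputable def RootedTree.wCount (T : RootedTree) (n : ℕ) : ℕ := T.out.wCount n

namespace PreTree

/-- A map on the vertices of a rooted tree is strict order preserving. -/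
def IsStrict {t : PreTree} {n : ℕ} (σ : Vert t → Fin n) : Prop :=
  ∀ p q : Vert t, p.1 <+: q.1 → p.1 ≠ q.1 → σ p < σ q

/-- The root of a tree. -/
def root (t : PreTree) : Vert t := ⟨[], trivial⟩

/-- The inclusion of the vertices of a branch into those of the whole tree. -/
def branch {l : List PreTree} (i : Fin l.length) (v : Vert (l.get i)) : Vert (node l) :=
  ⟨i.1 :: v.1, i.2, v.2⟩

lemma vert_cases {l : List PreTree} (v : Vert (node l)) :
    v = root (node l) ∨ ∃ i w, v = branch (l := l) i w := by
  obtain ⟨_ | ⟨i, p⟩, h⟩ := v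
  · exact Or.inl rfl
  · obtain ⟨hi, hp⟩ := h
    exact Or.inr ⟨⟨i, hi⟩, ⟨p, hp⟩, rfl⟩

theorem finite_vert : ∀ t : PreTree, Finite (Vert t)
  | node l => by
    have : ∀ i : Fin l.length, Finite (Vert (l.get i)) := fun i => finite_vert (l.get i)
    let f : Option (Σ i : Fin l.length, Vert (l.get i)) → Vert (node l) := fun o =>
      o.elim (root (node l)) fun x => branch x.1 x.2
    refine Finite.of_surjective f fun v => ?_
    obtain rfl | ⟨i, w, rfl⟩ := vert_cases v
    · exact ⟨none, rfl⟩
    · exact ⟨some ⟨i, w⟩, rfl⟩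
decreasing_by
  have h := List.sizeOf_lt_of_mem (List.get_mem l i)
  simp only [PreTree.node.sizeOf_spec]
  omega

instance (t : PreTree) : Finite (Vert t) := finite_vert t

lemma isStrict_node {l : List PreTree} {n : ℕ} {σ : Vert (node l) → Fin n} :
    IsStrict σ ↔ (∀ i w, σ (root (node l)) < σ (branch i w)) ∧
      ∀ i : Fin l.length, IsStrict fun w => σ (branch i w) := by
  constructor
  · refine fun h => ⟨fun i w => h _ _ List.nil_prefix (List.cons_ne_nil _ _).symm,
      fun i p q hpq hne => h _ _ ?_ ?_⟩
    · exact (List.prefix_cons_inj _).2 hpq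
    · exact fun e => hne (List.cons.inj e).2
  · rintro ⟨hr, hb⟩ p q hpq hne
    obtain rfl | ⟨i, p, rfl⟩ := vert_cases p <;> obtain rfl | ⟨j, q, rfl⟩ := vert_cases q
    · exact absurd rfl hne
    · exact hr j q
    · exact absurd (List.prefix_nil.1 hpq) (List.cons_ne_nil _ _)
    · obtain ⟨hij, hpq'⟩ := List.cons_prefix_cons.1 hpq
      obtain rfl := Fin.ext hij
      exact hb i p q hpq' fun e => hne (congrArg (i.1 :: ·) e)

lemma isStrict_succ {t : PreTree} {n : ℕ} {σ : Vert t → Fin n} :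
    IsStrict (fun v => (σ v).succ) ↔ IsStrict σ := by
  simp only [IsStrict, Fin.succ_lt_succ_iff]

/-- The map on a tree with root value `0` and the successors of given maps on the branches. -/
def graft {l : List PreTree} {n : ℕ} (f : ∀ i : Fin l.length, Vert (l.get i) → Fin n) :
    Vert (node l) → Fin (n + 1)
  | ⟨[], _⟩ => 0
  | ⟨i :: p, h⟩ => (f ⟨i, h.1⟩ ⟨p, h.2⟩).succ

lemma isStrict_graft {l : List PreTree} {n : ℕ}
    {f : ∀ i : Fin l.length, Vert (l.get i) → Fin n} (hf : ∀ i, IsStrict (f i)) :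
    IsStrict (graft f) :=
  isStrict_node.2 ⟨fun _ _ => Fin.succ_pos _, fun i => isStrict_succ.2 (hf i)⟩

theorem sCount_node_succ (l : List PreTree) (n : ℕ) :
    (node l).sCount (n + 1) = (node l).sCount n + (l.map fun t => t.sCount n).prod := by
  let F : {σ : Vert (node l) → Fin n // IsStrict σ} ⊕
      (∀ i : Fin l.length, {σ : Vert (l.get i) → Fin n // IsStrict σ}) →
      {σ : Vert (node l) → Fin (n + 1) // IsStrict σ} :=
    Sum.elim (fun σ => ⟨fun v => (σ.1 v).succ, isStrict_succ.2 σ.2⟩)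
      (fun f => ⟨graft fun i => (f i).1, isStrict_graft fun i => (f i).2⟩)
  have hF : Function.Bijective F := by
    constructor
    · rintro (σ | f) (τ | g) h
      · refine congrArg Sum.inl (Subtype.ext (funext fun v => Fin.succ_injective _ ?_))
        exact congrFun (congrArg Subtype.val h) v
      · exact absurd (congrFun (congrArg Subtype.val h) (root (node l))) (Fin.succ_ne_zero _)
      · exact absurd (congrFun (congrArg Subtype.val h) (root (node l))).symm
          (Fin.succ_ne_zero _)
      · refine congrArg Sum.inr (funext fun i => Subtype.ext (funext fun w =>
          Fin.succ_injective _ ?_))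
        exact congrFun (congrArg Subtype.val h) (branch i w)
    · rintro ⟨σ, hσ⟩
      obtain ⟨hr, hb⟩ := isStrict_node.1 hσ
      have hne : ∀ i w, σ (branch i w) ≠ 0 := fun i w => Fin.ne_zero_of_lt (hr i w)
      by_cases h0 : σ (root (node l)) = 0
      · refine ⟨Sum.inr fun i => ⟨fun w => (σ (branch i w)).pred (hne i w), ?_⟩,
          Subtype.ext (funext fun v => ?_)⟩
        · refine isStrict_succ.1 ?_
          simpa only [Fin.succ_pred] using hb i
        · obtain rfl | ⟨i, w, rfl⟩ := vert_cases v
          · exact h0.symm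
          · exact Fin.succ_pred _ (hne i w)
      · have hv : ∀ v, σ v ≠ 0 := fun v => by
          obtain rfl | ⟨i, w, rfl⟩ := vert_cases v
          exacts [h0, hne i w]
        refine ⟨Sum.inl ⟨fun v => (σ v).pred (hv v), ?_⟩,
          Subtype.ext (funext fun v => Fin.succ_pred _ (hv v))⟩
        refine isStrict_succ.1 ?_
        simpa only [Fin.succ_pred] using hσ
  have hcard := Nat.card_eq_of_bijective F hF
  rw [Nat.card_sum, Nat.card_pi] at hcard
  refine hcard.symm.trans (congrArg (_ + ·) ?_)
  rw [← Fin.prod_univ_fun_getElem]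
  rfl

theorem sCount_zero (t : PreTree) : t.sCount 0 = 0 := by
  have : IsEmpty (Vert t → Fin 0) := ⟨fun σ => (σ (root t)).elim0⟩
  exact Nat.card_of_isEmpty

theorem sCount_node_congr {l l' : List PreTree}
    (h : ∀ n, (l.map fun t => t.sCount n).prod = (l'.map fun t => t.sCount n).prod) (n : ℕ) :
    (node l).sCount n = (node l').sCount n := by
  induction n with
  | zero => rw [sCount_zero, sCount_zero]
  | succ n ih => rw [sCount_node_succ, sCount_node_succ, ih, h]

theorem Equiv.sCount_eq {a b : PreTree} (h : Equiv a b) (n : ℕ) : a.sCount n = b.sCount n := by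
  induction h generalizing n with
  | refl => rfl
  | symm _ ih => exact (ih n).symm
  | trans _ _ ih₁ ih₂ => exact (ih₁ n).trans (ih₂ n)
  | perm h => exact sCount_node_congr (fun n => (h.map _).prod_eq) n
  | congr l₁ l₂ _ ih => exact sCount_node_congr (fun n => by simp [ih n]) n

end PreTree

/-- `Ω̄(B₊(s))(n+1) − Ω̄(B₊(s))(n) = ∏_{T ∈ s} Ω̄(T)(n)`. -/
theorem strict_order_count_recursion (s : Multiset RootedTree) (n : ℕ) :
    ((RootedTree.node s).sCount (n + 1) : ℤ) - ((RootedTree.node s).sCount n : ℤ) =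
      (s.map fun T => (T.sCount n : ℤ)).prod := by
  have h : ∀ k, (RootedTree.node s).sCount k =
      (PreTree.node (s.map Quotient.out).toList).sCount k :=
    fun k =>
      PreTree.Equiv.sCount_eq (Quotient.exact (Quotient.out_eq (RootedTree.node s))) k
  have hprod : ((s.map Quotient.out).toList.map fun t => PreTree.sCount t n).prod =
      (s.map fun T => T.sCount n).prod := by
    rw [← Multiset.prod_coe, ← Multiset.map_coe, Multiset.coe_toList]
    exact congrArg Multiset.prod (Multiset.map_map _ _ _)
  rw [h, h, PreTree.sCount_node_succ, hprod, Nat.cast_add, add_sub_cancel_left,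
    Nat.cast_multiset_prod, Multiset.map_map]
  rfl

end ZhaoForest
end

section
/- For every multiset s of rooted trees and every integer n ≥ 1, the number of order preserving maps from B₊(s) to [n] minus the number of order preserving maps from B₊(s) to [n−1] equals the product over T ∈ s of the number of order preserving maps from T to [n]; in symbols, Ω(B₊(s))(n) − Ω(B₊(s))(n−1) = ∏_{T ∈ s} Ω(T)(n). -/
namespace ZhaoForest

/-- Weakly order preserving maps from the vertices of `t` to `Fin n`. -/
abbrev OrderMap (t : PreTree) (n : ℕ) : Type :=
  {σ : Vert t → Fin n // ∀ p q : Vert t, p.1 <+: q.1 → p.1 ≠ q.1 → σ p ≤ σ q}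

namespace Vert

/-- The root of a tree. -/
def root (t : PreTree) : Vert t := ⟨[], trivial⟩

/-- The vertex of `node l` given by a vertex of its `i`-th child. -/
def child {l : List PreTree} (i : Fin l.length) (p : Vert (l.get i)) : Vert (PreTree.node l) :=
  ⟨i.1 :: p.1, ⟨i.2, p.2⟩⟩

/-- A map on the vertices of `node l`, from a value at the root and maps on the children. -/
def glue {α : Type} {l : List PreTree} (a : α) (g : ∀ i : Fin l.length, Vert (l.get i) → α) :
    Vert (PreTree.node l) → α
  | ⟨[], _⟩ => a
  | ⟨i :: p, h⟩ => g ⟨i, h.fst⟩ ⟨p, h.snd⟩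

theorem eq_root_or_child {l : List PreTree} (p : Vert (PreTree.node l)) :
    p = root _ ∨ ∃ i q, p = child i q := by
  obtain ⟨_ | ⟨i, p⟩, h⟩ := p
  · exact Or.inl rfl
  · exact Or.inr ⟨⟨i, h.fst⟩, ⟨p, h.snd⟩, rfl⟩

theorem finite : ∀ t : PreTree, Finite (Vert t)
  | .node l => by
    have (i : Fin l.length) : Finite (Vert (l.get i)) := finite (l.get i)
    refine Finite.of_surjective (α := Option (Σ i : Fin l.length, Vert (l.get i)))
      (fun o => o.elim (root _) fun x => child x.1 x.2) fun p => ?_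
    obtain rfl | ⟨i, q, rfl⟩ := eq_root_or_child p
    · exact ⟨none, rfl⟩
    · exact ⟨some ⟨i, q⟩, rfl⟩
termination_by t => sizeOf t
decreasing_by
  have h := List.sizeOf_lt_of_mem (List.get_mem l i)
  simp only [PreTree.node.sizeOf_spec]
  omega

end Vert

instance (t : PreTree) : Finite (Vert t) := Vert.finite t

namespace OrderMap

theorem root_le {t : PreTree} {n : ℕ} (σ : OrderMap t n) (p : Vert t) :
    σ.1 (Vert.root t) ≤ σ.1 p := by
  by_cases h : p = Vert.root t
  · rw [h]
  · exact σ.2 _ _ (List.nil_prefix) fun e => h (Subtype.ext e.symm)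

/-- An order preserving map to `Fin (n + 1)` avoids `0`, or is `0` at the root. -/
def ofSum (l : List PreTree) (n : ℕ) :
    OrderMap (PreTree.node l) n ⊕ (∀ i : Fin l.length, OrderMap (l.get i) (n + 1)) →
      OrderMap (PreTree.node l) (n + 1)
  | .inl σ => ⟨fun p => (σ.1 p).succ, fun p q h h' => Fin.succ_le_succ_iff.2 (σ.2 p q h h')⟩
  | .inr g => ⟨Vert.glue 0 fun i => (g i).1, by
      intro p q h hne
      obtain rfl | ⟨i, p, rfl⟩ := Vert.eq_root_or_child p
      · exact Fin.zero_le _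
      obtain rfl | ⟨j, q, rfl⟩ := Vert.eq_root_or_child q
      · simp [Vert.child, Vert.root] at h
      obtain ⟨hij, h⟩ := List.cons_prefix_cons.1 h
      obtain rfl := Fin.ext hij
      exact (g i).2 p q h fun e => hne (congrArg (i.1 :: ·) e)⟩

theorem ofSum_bijective (l : List PreTree) (n : ℕ) : Function.Bijective (ofSum l n) := by
  constructor
  · rintro (σ | g) (τ | g') h <;> have h := congrArg Subtype.val h
    · exact congrArg Sum.inl (Subtype.ext (funext fun p => Fin.succ_injective _ (congrFun h p)))
    · exact absurd (congrFun h (Vert.root _)) (Fin.succ_ne_zero _)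
    · exact absurd (congrFun h (Vert.root _)).symm (Fin.succ_ne_zero _)
    · exact congrArg Sum.inr (funext fun i => Subtype.ext (funext fun p =>
        congrFun h (Vert.child i p)))
  · intro σ
    by_cases h0 : σ.1 (Vert.root _) = 0
    · refine ⟨.inr fun i => ⟨fun p => σ.1 (Vert.child i p), fun p q h hne => σ.2 _ _
        (List.cons_prefix_cons.2 ⟨rfl, h⟩) fun e => hne (List.cons.inj e).2⟩,
        Subtype.ext (funext fun p => ?_)⟩
      obtain rfl | ⟨i, q, rfl⟩ := Vert.eq_root_or_child p
      · exact h0.symm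
      · rfl
    · have hpos (p) : σ.1 p ≠ 0 := fun e => h0 (Fin.le_zero_iff.1 (e ▸ root_le σ p))
      exact ⟨.inl ⟨fun p => (σ.1 p).pred (hpos p), fun p q h hne =>
        Fin.pred_le_pred_iff.2 (σ.2 p q h hne)⟩,
        Subtype.ext (funext fun p => Fin.succ_pred _ (hpos p))⟩

end OrderMap

namespace PreTree

theorem wCount_zero (t : PreTree) : t.wCount 0 = 0 :=
  have : IsEmpty (OrderMap t 0) := ⟨fun σ => (σ.1 (Vert.root t)).elim0⟩
  Nat.card_of_isEmpty (α := OrderMap t 0)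

theorem wCount_node_succ (l : List PreTree) (n : ℕ) :
    (node l).wCount (n + 1) = (node l).wCount n + (l.map (·.wCount (n + 1))).prod := by
  have h := Nat.card_congr (Equiv.ofBijective _ (OrderMap.ofSum_bijective l n))
  rw [Nat.card_sum, Nat.card_pi] at h
  refine h.symm.trans (congrArg (_ + ·) ?_)
  exact (Fin.prod_univ_fun_getElem l (wCount · (n + 1)))

theorem Equiv.wCount_eq {a b : PreTree} (h : Equiv a b) (n : ℕ) : a.wCount n = b.wCount n := by
  induction h generalizing n with
  | refl => rfl
  | symm _ ih => exact (ih n).symm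
  | trans _ _ ih₁ ih₂ => exact (ih₁ n).trans (ih₂ n)
  | perm h =>
    induction n with
    | zero => simp only [wCount_zero]
    | succ n ih => rw [wCount_node_succ, wCount_node_succ, ih, (h.map _).prod_eq]
  | congr l₁ l₂ _ ih =>
    induction n with
    | zero => simp only [wCount_zero]
    | succ n ihn => simp [wCount_node_succ, ihn, ih]

end PreTree

theorem RootedTree.wCount_mk (t : PreTree) (n : ℕ) :
    RootedTree.wCount (⟦t⟧ : RootedTree) n = t.wCount n :=
  PreTree.Equiv.wCount_eq (Quotient.mk_out t) n

/-- for `n ≥ 1`, `Ω(B₊(s))(n) − Ω(B₊(s))(n−1) = ∏_{T ∈ s} Ω(T)(n)`. -/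
theorem order_count_recursion (s : Multiset RootedTree) (n : ℕ) (hn : 1 ≤ n) :
    ((RootedTree.node s).wCount n : ℤ) - ((RootedTree.node s).wCount (n - 1) : ℤ) =
      (s.map fun T => (T.wCount n : ℤ)).prod := by
  obtain ⟨n, rfl⟩ := Nat.exists_eq_add_of_le' hn
  have key : (((s.map Quotient.out).toList).map fun t : PreTree => t.wCount (n + 1)).prod =
      (s.map fun T => T.wCount (n + 1)).prod := by
    rw [← Multiset.prod_coe, ← Multiset.map_coe, Multiset.coe_toList]
    exact congrArg Multiset.prod (Multiset.map_map _ _ s)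
  rw [RootedTree.node, RootedTree.wCount_mk, RootedTree.wCount_mk, PreTree.wCount_node_succ, key,
    Nat.add_sub_cancel, Nat.cast_add, add_sub_cancel_left, Nat.cast_multiset_prod,
    Multiset.map_map]
  rfl

end ZhaoForest
end
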